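/- Let C ⊆ 𝔽₂^N be a binary linear code with BPSK image C_x ⊆ {±1}^N, let X be uniformly distributed on C_x, let Z be a real random vector independent of X with independent and identically distributed components, let Z' be an independent copy of Z, and set Y = X ⊙ Z and Y' = X ⊙ Z'. Fix i ∈ {0,…,N−1} and pairwise disjoint sets A, B, C' ⊆ {0,…,N−1}∖{i}, and suppose there exists a permutation matrix Π such that (X_i, X_A, X_B) is equal in distribution to (X_i, X_A, Π X_{C'}). Then the pair ( E[X_i | Y_A, Y_B], E[X_i | Y_A, Y'_B] ) is equal in distribution to the pair ( E[X_i | Y_A, Y_B], E[X_i | Y_A, Y_{C'}] ). -/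

import Mathlib

open MeasureTheory ProbabilityTheory

noncomputable section

/-- The binary entropy function (base 2). -/
def hb (p : ℝ) : ℝ := -(p * Real.logb 2 p) - (1 - p) * Real.logb 2 (1 - p)

/-- Conditional expectation `E[X | W]` of `X` given the σ-algebra generated by `W`. -/
def condMean {Ω β E : Type*} [MeasurableSpace Ω] [MeasurableSpace β]
    [NormedAddCommGroup E] [NormedSpace ℝ E] [CompleteSpace E]
    (μ : Measure Ω) (X : Ω → E) (W : Ω → β) : Ω → E :=
  μ[X | MeasurableSpace.comap W inferInstance]

/-- Bit-error probability of the MAP decision rule for `X ∈ {±1}` given `W`. -/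
def BER {Ω β : Type*} [MeasurableSpace Ω] [MeasurableSpace β]
    (μ : Measure Ω) (X : Ω → ℝ) (W : Ω → β) : ℝ :=
  (1 - ∫ ω, |condMean μ X W ω| ∂μ) / 2

/-- Minimum mean squared error of estimating `X` from `W`. -/
def mmse {Ω β : Type*} [MeasurableSpace Ω] [MeasurableSpace β]
    (μ : Measure Ω) (X : Ω → ℝ) (W : Ω → β) : ℝ :=
  ∫ ω, (X ω - condMean μ X W ω) ^ 2 ∂μ

/-- Uniform distribution on `{-1, 1} ⊆ ℝ`. -/
def signMeasure : Measure ℝ := (2 : ENNReal)⁻¹ • (Measure.dirac (-1) + Measure.dirac 1)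

/-- Capacity of the BMS channel (in multiplicative-noise form) with noise law `PZ`:
`C = 1 - E[h_b((1 + E[X_u | Y_u])/2)]` where `X_u` is uniform on `{±1}`, independent of
`Z₀ ~ PZ`, and `Y_u = X_u · Z₀`. -/
def capacity (PZ : Measure ℝ) : ℝ :=
  1 - ∫ p, hb ((1 + condMean (signMeasure.prod PZ)
        (fun q : ℝ × ℝ => q.1) (fun q : ℝ × ℝ => q.1 * q.2) p) / 2) ∂(signMeasure.prod PZ)

/-- Evaluation vector of the multilinear polynomial whose coefficients on monomials
of degree at most `r` are given by `α` (higher-degree coefficients being ignored),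
evaluated at the point `v ∈ 𝔽₂^m` with index `i = Σ_j v_j 2^j`. -/
def RMword (r m : ℕ) (α : Finset (Fin m) → ZMod 2) : Fin (2 ^ m) → ZMod 2 :=
  fun i => ∑ S ∈ Finset.univ.filter (fun S : Finset (Fin m) => S.card ≤ r),
    α S * ∏ j ∈ S, ((((i : ℕ) / 2 ^ (j : ℕ)) % 2 : ℕ) : ZMod 2)

/-- The Reed–Muller code RM(r, m) ⊆ 𝔽₂^{2^m}. -/
def RMcode (r m : ℕ) : Finset (Fin (2 ^ m) → ZMod 2) :=
  Finset.image (RMword r m) Finset.univ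

/-- The rate `R(r,m)` of RM(r,m). -/
def RMrate (r m : ℕ) : ℝ := (2 ^ m : ℝ)⁻¹ * ∑ i ∈ Finset.range (r + 1), (m.choose i : ℝ)

/-- BPSK modulation map `c ↦ ((-1)^{c_0}, …, (-1)^{c_{N-1}})`. -/
def bpsk {N : ℕ} (c : Fin N → ZMod 2) : Fin N → ℝ := fun i => (-1 : ℝ) ^ ((c i).val)

/-- BPSK image of a binary code. -/
def bpskImage {N : ℕ} (C : Finset (Fin N → ZMod 2)) : Finset (Fin N → ℝ) :=
  letI := Classical.decEq (Fin N → ℝ)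
  C.image bpsk

/-- BPSK image of RM(r,m). -/
def bpskRM (r m : ℕ) : Finset (Fin (2 ^ m) → ℝ) := bpskImage (RMcode r m)

/-- Uniform probability measure on a finite set. -/
def uniformOnFinset {α : Type*} [MeasurableSpace α] (s : Finset α) : Measure α :=
  (s.card : ENNReal)⁻¹ • ∑ x ∈ s, Measure.dirac x

/-- `ρ(m) = (6 ln m + 34)/(5 √m)`. -/
def rho (m : ℕ) : ℝ := (6 * Real.log m + 34) / (5 * Real.sqrt m)

/-- Inverse of the binary entropy function restricted to `[0, 1/2]`. -/
def hbInv (u : ℝ) : ℝ := sSup {p : ℝ | p ∈ Set.Icc (0 : ℝ) (1 / 2) ∧ hb p ≤ u}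

/-- `ψ(u) = 1 - (1 - 2 h_b^{-1}(u))²`. -/
def psi (u : ℝ) : ℝ := 1 - (1 - 2 * hbInv u) ^ 2

/-- `Ψ(u) = ∫₀^u ψ(v) dv`. -/
def PsiInt (u : ℝ) : ℝ := ∫ v in (0 : ℝ)..u, psi v

/-- The coefficients `c_k = 1/(ln 2 · 2k (2k-1))`. -/
def ck (k : ℕ) : ℝ := 1 / (Real.log 2 * (2 * k) * (2 * k - 1))

/-- The channel moments `q_k = E[(E[X_u | Y_u])^{2k}]` for uniform input. -/
def qmom (PZ : Measure ℝ) (k : ℕ) : ℝ :=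
  ∫ p, (condMean (signMeasure.prod PZ)
      (fun q : ℝ × ℝ => q.1) (fun q : ℝ × ℝ => q.1 * q.2) p) ^ (2 * k) ∂(signMeasure.prod PZ)

end

lemma s14_condDistrib_congr {Ω Ω' β : Type*} [MeasurableSpace Ω] [MeasurableSpace Ω']
    [MeasurableSpace β] (μ : Measure Ω) [IsFiniteMeasure μ] (μ' : Measure Ω') [IsFiniteMeasure μ']
    (X : Ω → ℝ) (W : Ω → β) (X' : Ω' → ℝ) (W' : Ω' → β)
    (h : μ.map (fun a => (W a, X a)) = μ'.map (fun a => (W' a, X' a))) :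
    condDistrib X W μ = condDistrib X' W' μ' := by
  rw [condDistrib, condDistrib]
  simp only [h]

lemma s14_comap_eq {Ω β γ : Type*} [mβ : MeasurableSpace β] [mγ : MeasurableSpace γ]
    (W : Ω → β) (W' : Ω → γ) (φ : β → γ) (ψ : γ → β) (hφ : Measurable φ) (hψ : Measurable ψ)
    (h1 : ∀ ω, W' ω = φ (W ω)) (h2 : ∀ ω, W ω = ψ (W' ω)) :
    mβ.comap W = mγ.comap W' := by
  have e1 : W' = φ ∘ W := funext h1
  have e2 : W = ψ ∘ W' := funext h2
  apply le_antisymm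
  · rw [e2, ← MeasurableSpace.comap_comp]
    exact MeasurableSpace.comap_mono hψ.comap_le
  · rw [e1, ← MeasurableSpace.comap_comp]
    exact MeasurableSpace.comap_mono hφ.comap_le

lemma s14_key {K : Type*} [Fintype K] (PZ : Measure ℝ) [IsProbabilityMeasure PZ]
    (L : Measure (ℝ × (K → ℝ))) [IsProbabilityMeasure L] (U : Finset (ℝ × (K → ℝ)))
    (hU : ∀ᵐ s ∂L, s ∈ U) (hsq : ∀ u ∈ U, u * u = 1)
    (hinv : ∀ u ∈ U, L.map (fun s => u * s) = L) :
    ∃ f : (K → ℝ) → ℝ, Measurable f ∧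
      ∀ {Ω : Type _} [MeasurableSpace Ω] (μ : Measure Ω) [IsProbabilityMeasure μ]
        (S : Ω → ℝ × (K → ℝ)) (V : Ω → K → ℝ), Measurable S → Measurable V →
        μ.map (fun ω => (S ω, V ω)) = L.prod (Measure.pi fun _ => PZ) →
        condMean μ (fun ω => (S ω).1) (fun ω => (S ω).2 * V ω)
          =ᵐ[μ] fun ω => (S ω).1 * f (V ω) := by
  set P : Measure (K → ℝ) := Measure.pi fun _ => PZ
  let f : (K → ℝ) → ℝ := fun w => ∫ y, y ∂(condDistrib
    (fun p : (ℝ × (K → ℝ)) × (K → ℝ) => p.1.1) (fun p => p.1.2 * p.2) (L.prod P) w)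
  refine ⟨f, ?_, ?_⟩
  · exact (StronglyMeasurable.integral_kernel stronglyMeasurable_id).measurable
  intro Ω _ μ _ S V hS hV hlaw
  have hSU : ∀ᵐ ω ∂μ, S ω ∈ U := by
    have : μ.map S = L := by
      have := congrArg (fun m => m.map Prod.fst) hlaw
      rw [Measure.map_map measurable_fst (hS.prodMk hV), Measure.map_fst_prod] at this
      simpa [Function.comp_def] using this
    rw [← this] at hU
    exact ae_of_ae_map hS.aemeasurable hU
  -- general conditional mean formula
  have hgen : ∀ S' : Ω → ℝ × (K → ℝ), Measurable S' → (∀ᵐ ω ∂μ, ‖(S' ω).1‖ ≤ 1) →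
      μ.map (fun ω => (S' ω, V ω)) = L.prod P →
      condMean μ (fun ω => (S' ω).1) (fun ω => (S' ω).2 * V ω)
        =ᵐ[μ] fun ω => f ((S' ω).2 * V ω) := by
    intro S' hS' hb hl
    have hY : Measurable (fun ω => (S' ω).2 * V ω) := hS'.snd.mul hV
    have hint : Integrable (fun ω => (S' ω).1) μ :=
      Integrable.of_bound hS'.fst.aestronglyMeasurable 1 hb
    have h1 := condExp_ae_eq_integral_condDistrib' hY hint
    have h2 : condDistrib (fun ω => (S' ω).1) (fun ω => (S' ω).2 * V ω) μ
        = condDistrib (fun p : (ℝ × (K → ℝ)) × (K → ℝ) => p.1.1)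
          (fun p => p.1.2 * p.2) (L.prod P) := by
      apply s14_condDistrib_congr
      rw [← hl, Measure.map_map (by fun_prop) (hS'.prodMk hV)]
      rfl
    rw [h2] at h1
    exact h1
  have hone : ∀ u ∈ U, ‖u.1‖ ≤ 1 := by
    intro u hu
    have := congrArg Prod.fst (hsq u hu)
    simp only [Prod.fst_mul, Prod.fst_one] at this
    rw [Real.norm_eq_abs, abs_le]
    constructor <;> nlinarith
  have hb : ∀ᵐ ω ∂μ, ‖(S ω).1‖ ≤ 1 := by
    filter_upwards [hSU] with ω h using hone _ h
  have hbase := hgen S hS hb hlaw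
  have heq : ∀ u ∈ U, ∀ᵐ ω ∂μ, f (u.2 * ((S ω).2 * V ω)) = u.1 * f ((S ω).2 * V ω) := by
    intro u hu
    have hm : Measurable (fun ω => u * S ω) := hS.const_mul u
    have h1 := hgen (fun ω => u * S ω) hm ?_ ?_
    · have hc : condMean μ (fun ω => (u * S ω).1) (fun ω => (u * S ω).2 * V ω)
          = μ[u.1 • (fun ω => (S ω).1) | MeasurableSpace.comap (fun ω => (S ω).2 * V ω)
              inferInstance] := by
        unfold condMean
        have hu2 : u.2 * u.2 = 1 := congrArg Prod.snd (hsq u hu)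
        rw [s14_comap_eq (fun ω => (u * S ω).2 * V ω) (fun ω => (S ω).2 * V ω)
          (fun w => u.2 * w) (fun w => u.2 * w) (measurable_const_mul _) (measurable_const_mul _)
          (fun ω => by
            simp only [Prod.snd_mul]
            rw [← mul_assoc, ← mul_assoc, hu2, one_mul])
          (fun ω => by simp only [Prod.snd_mul, mul_assoc])]
        rfl
      rw [hc] at h1
      have h2 := condExp_smul (μ := μ) u.1 (fun ω => (S ω).1)
        (MeasurableSpace.comap (fun ω => (S ω).2 * V ω) inferInstance)
      filter_upwards [h1, h2, hbase] with ω a1 a2 a3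
      rw [a2] at a1
      simp only [Pi.smul_apply, smul_eq_mul, Prod.snd_mul] at a1
      rw [← mul_assoc, ← a1, ← a3]
      rfl
    · filter_upwards [hSU] with ω h
      rw [Prod.fst_mul, norm_mul]
      exact mul_le_one₀ (hone u hu) (norm_nonneg _) (hone _ h)
    · have : (fun ω => (u * S ω, V ω)) = Prod.map (fun s => u * s) id ∘ fun ω => (S ω, V ω) := rfl
      rw [this, ← Measure.map_map (by fun_prop) (hS.prodMk hV), hlaw,
        ← Measure.map_prod_map _ _ (by fun_prop) measurable_id, hinv u hu, Measure.map_id]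
  have hall : ∀ᵐ ω ∂μ, ∀ u ∈ U, f (u.2 * ((S ω).2 * V ω)) = u.1 * f ((S ω).2 * V ω) :=
    (Finset.eventually_all U).2 heq
  filter_upwards [hall, hSU, hbase] with ω h1 h2 h3
  have h4 := h1 _ h2
  have hu1 : (S ω).1 * (S ω).1 = 1 := congrArg Prod.fst (hsq _ h2)
  have hu2 : (S ω).2 * (S ω).2 = 1 := congrArg Prod.snd (hsq _ h2)
  rw [← mul_assoc, hu2, one_mul] at h4
  rw [h3, h4, ← mul_assoc, hu1, one_mul]

lemma s14_pi_map {ι K : Type*} [Fintype ι] [Fintype K] (PZ : Measure ℝ) [IsProbabilityMeasure PZ]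
    (e : K → ι) (he : Function.Injective e) :
    (Measure.pi fun _ : ι => PZ).map (fun z k => z (e k)) = Measure.pi fun _ : K => PZ := by
  classical
  symm
  apply Measure.pi_eq
  intro s hs
  rw [Measure.map_apply (by fun_prop) (MeasurableSet.univ_pi hs)]
  have : (fun (z : ι → ℝ) k => z (e k)) ⁻¹' Set.univ.pi s
      = Set.univ.pi (fun i => ⋂ k, {x | e k = i → x ∈ s k}) := by
    ext z
    simp only [Set.mem_preimage, Set.mem_pi, Set.mem_univ, true_imp_iff, Set.mem_iInter,
      Set.mem_ofPred_eq]
    exact ⟨fun h i k hk => hk ▸ h k, fun h k => h _ k rfl⟩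
  rw [this, Measure.pi_pi]
  rw [← Finset.prod_subset (Finset.subset_univ (Finset.univ.image e))]
  · rw [Finset.prod_image (fun a _ b _ h => he h)]
    refine Finset.prod_congr rfl fun k _ => ?_
    congr 1
    ext x
    simp [he.eq_iff]
  · intro i _ hi
    have : (⋂ k, {x | e k = i → x ∈ s k}) = Set.univ := by
      ext x
      simp only [Finset.mem_image, Finset.mem_univ, true_and, not_exists] at hi
      simp [hi]
    rw [this, measure_univ]

lemma s14_prod_map {N : ℕ} {K : Type*} [Fintype K] (PZ : Measure ℝ) [IsProbabilityMeasure PZ]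
    (e : K → Fin N ⊕ Fin N) (he : Function.Injective e) :
    ((Measure.pi fun _ : Fin N => PZ).prod (Measure.pi fun _ : Fin N => PZ)).map
      (fun p k => Sum.elim p.1 p.2 (e k)) = Measure.pi fun _ : K => PZ := by
  have h := (measurePreserving_sumPiEquivProdPi_symm (fun _ : Fin N ⊕ Fin N => PZ)).map_eq
  rw [← s14_pi_map PZ e he, ← h, Measure.map_map (by fun_prop) (MeasurableEquiv.measurable _)]
  congr 1

lemma s14_law {Ω T K : Type*} [MeasurableSpace Ω] [MeasurableSpace T] [Fintype K]
    (μ : Measure Ω) {N : ℕ} (Q : Measure (Fin N → ℝ)) [SFinite Q]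
    (PZ : Measure ℝ) [IsProbabilityMeasure PZ]
    (X Z Z' : Ω → (Fin N → ℝ))
    (hX : Measurable X) (hZ : Measurable Z) (hZ' : Measurable Z')
    (hlaw : Measure.map (fun ω => (X ω, Z ω, Z' ω)) μ
        = Q.prod ((Measure.pi fun _ => PZ).prod (Measure.pi fun _ => PZ)))
    (φ : (Fin N → ℝ) → T) (hφ : Measurable φ)
    (e : K → Fin N ⊕ Fin N) (he : Function.Injective e) :
    μ.map (fun ω => (φ (X ω), fun k => Sum.elim (Z ω) (Z' ω) (e k)))
      = (Q.map φ).prod (Measure.pi fun _ : K => PZ) := by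
  have hm : Measurable
      (fun (p : (Fin N → ℝ) × (Fin N → ℝ)) (k : K) => Sum.elim p.1 p.2 (e k)) := by
    refine measurable_pi_lambda _ fun k => ?_
    rcases e k with a | a <;> simp only [Sum.elim_inl, Sum.elim_inr] <;> fun_prop
  rw [← s14_prod_map PZ e he, Measure.map_prod_map _ _ hφ hm, ← hlaw,
    Measure.map_map (hφ.prodMap hm) (by fun_prop)]
  rfl

lemma s14_bpsk_add {N : ℕ} (u v : Fin N → ZMod 2) : bpsk (u + v) = bpsk u * bpsk v := by
  ext i
  simp only [bpsk, Pi.add_apply, Pi.mul_apply]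
  generalize u i = a
  generalize v i = b
  have h01 : ∀ c : ZMod 2, c = 0 ∨ c = 1 := by decide
  have e0 : (0 : ZMod 2).val = 0 := rfl
  have e1 : (1 : ZMod 2).val = 1 := rfl
  have e2 : ((1 : ZMod 2) + 1).val = 0 := rfl
  rcases h01 a with rfl | rfl <;> rcases h01 b with rfl | rfl <;> simp [e0, e1, e2]

lemma s14_bpsk_sq {N : ℕ} (u : Fin N → ZMod 2) : bpsk u * bpsk u = 1 := by
  ext i
  simp only [bpsk, Pi.mul_apply, Pi.one_apply, ← mul_pow]
  norm_num

lemma s14_mem_image {N : ℕ} (C : Finset (Fin N → ZMod 2)) (x : Fin N → ℝ) :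
    x ∈ bpskImage C ↔ ∃ u ∈ C, bpsk u = x := by
  simp [bpskImage]

lemma s14_unif_inv {N : ℕ} (C : Finset (Fin N → ZMod 2))
    (hadd : ∀ u ∈ C, ∀ v ∈ C, u + v ∈ C) (x : Fin N → ℝ) (hx : x ∈ bpskImage C) :
    (uniformOnFinset (bpskImage C)).map (fun y => x * y) = uniformOnFinset (bpskImage C) := by
  have hm : Measurable (fun y : Fin N → ℝ => x * y) := measurable_const_mul x
  have hxx : x * x = 1 := by
    obtain ⟨u, _, rfl⟩ := (s14_mem_image C x).1 hx
    exact s14_bpsk_sq u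
  have hcl : ∀ y ∈ bpskImage C, x * y ∈ bpskImage C := by
    intro y hy
    obtain ⟨u, hu, rfl⟩ := (s14_mem_image C x).1 hx
    obtain ⟨v, hv, rfl⟩ := (s14_mem_image C y).1 hy
    exact (s14_mem_image C _).2 ⟨u + v, hadd u hu v hv, s14_bpsk_add u v⟩
  unfold uniformOnFinset
  rw [Measure.map_smul, ← Measure.mapₗ_apply_of_measurable hm, map_sum]
  congr 1
  refine Finset.sum_nbij' (fun y => x * y) (fun y => x * y) hcl hcl ?_ ?_ ?_
  · intro y _
    rw [← mul_assoc, hxx, one_mul]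
  · intro y _
    rw [← mul_assoc, hxx, one_mul]
  · intro y _
    rw [Measure.mapₗ_apply_of_measurable hm, Measure.map_dirac' hm]

lemma s14_unif_mem {N : ℕ} (s : Finset (Fin N → ℝ)) :
    ∀ᵐ x ∂(uniformOnFinset s), x ∈ s := by
  have hms : MeasurableSet {x | ¬ x ∈ s} := s.measurableSet.compl
  rw [ae_iff, uniformOnFinset, Measure.smul_apply, Measure.finsetSum_apply]
  rw [Finset.sum_eq_zero, smul_zero]
  intro x hx
  rw [Measure.dirac_apply' _ hms]
  simp [hx]

lemma s14_condMean_congr {Ω β γ : Type*} [MeasurableSpace Ω] [MeasurableSpace β]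
    [MeasurableSpace γ] (μ : Measure Ω) (X : Ω → ℝ)
    (W : Ω → β) (W' : Ω → γ) (φ : β → γ) (ψ : γ → β) (hφ : Measurable φ) (hψ : Measurable ψ)
    (h1 : ∀ ω, W' ω = φ (W ω)) (h2 : ∀ ω, W ω = ψ (W' ω)) :
    condMean μ X W = condMean μ X W' := by
  unfold condMean
  rw [s14_comap_eq W W' φ ψ hφ hψ h1 h2]

lemma s14_measurable_elim {T I J : Type*} [MeasurableSpace T] (p : T → I → ℝ) (q : T → J → ℝ)
    (hp : Measurable p) (hq : Measurable q) : Measurable (fun t => Sum.elim (p t) (q t)) := by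
  refine measurable_pi_lambda _ fun k => ?_
  rcases k with a | a
  · exact (measurable_pi_apply a).comp hp
  · exact (measurable_pi_apply a).comp hq


/-- for a binary linear code on a BMS channel with i.i.d. noise and a
second independent use `Y' = X ⊙ Z'`, if `(X_i, X_A, X_B)` is equal in distribution to
`(X_i, X_A, Π X_{C'})` for disjoint sets `A, B, C' ⊆ [N]∖{i}` and a permutation matrix
`Π` (encoded by the bijection `g : B ≃ C'`), then
`(E[X_i|Y_A,Y_B], E[X_i|Y_A,Y'_B]) =d (E[X_i|Y_A,Y_B], E[X_i|Y_A,Y_{C'}])`. -/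
theorem stmt_14 {Ω : Type*} [MeasurableSpace Ω] (μ : Measure Ω) [IsProbabilityMeasure μ]
    (N : ℕ) (C : Finset (Fin N → ZMod 2))
    (h0 : (0 : Fin N → ZMod 2) ∈ C)
    (hadd : ∀ u ∈ C, ∀ v ∈ C, u + v ∈ C)
    (PZ : Measure ℝ) [IsProbabilityMeasure PZ]
    (X Z Z' : Ω → (Fin N → ℝ))
    (hX : Measurable X) (hZ : Measurable Z) (hZ' : Measurable Z')
    (hlaw : Measure.map (fun ω => (X ω, Z ω, Z' ω)) μ
        = (uniformOnFinset (bpskImage C)).prod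
            ((Measure.pi fun _ => PZ).prod (Measure.pi fun _ => PZ)))
    (i : Fin N) (A B C' : Finset (Fin N))
    (hiA : i ∉ A) (hiB : i ∉ B) (hiC : i ∉ C')
    (hAB : Disjoint A B) (hAC : Disjoint A C') (hBC : Disjoint B C')
    (g : {x // x ∈ B} ≃ {x // x ∈ C'})
    (hdist : Measure.map
        (fun ω => (X ω i,
          fun a : {x // x ∈ A} => X ω a.1,
          fun b : {x // x ∈ B} => X ω b.1)) μ
      = Measure.map
        (fun ω => (X ω i,
          fun a : {x // x ∈ A} => X ω a.1,
          fun b : {x // x ∈ B} => X ω (g b).1)) μ) :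
    Measure.map
      (fun ω =>
        (condMean μ (fun ω' => X ω' i)
          (fun ω' => ((fun a : {x // x ∈ A} => X ω' a.1 * Z ω' a.1),
                      (fun b : {x // x ∈ B} => X ω' b.1 * Z ω' b.1))) ω,
         condMean μ (fun ω' => X ω' i)
          (fun ω' => ((fun a : {x // x ∈ A} => X ω' a.1 * Z ω' a.1),
                      (fun b : {x // x ∈ B} => X ω' b.1 * Z' ω' b.1))) ω)) μ
    = Measure.map
      (fun ω =>
        (condMean μ (fun ω' => X ω' i)
          (fun ω' => ((fun a : {x // x ∈ A} => X ω' a.1 * Z ω' a.1),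
                      (fun b : {x // x ∈ B} => X ω' b.1 * Z ω' b.1))) ω,
         condMean μ (fun ω' => X ω' i)
          (fun ω' => ((fun a : {x // x ∈ A} => X ω' a.1 * Z ω' a.1),
                      (fun c : {x // x ∈ C'} => X ω' c.1 * Z ω' c.1))) ω)) μ := by
  classical
  set Q := uniformOnFinset (bpskImage C) with hQ
  have hXQ : μ.map X = Q := by
    have := congrArg (fun m => m.map Prod.fst) hlaw
    rw [Measure.map_map measurable_fst (by fun_prop), Measure.map_fst_prod] at this
    simpa [Function.comp_def] using this
  have : IsProbabilityMeasure Q := hXQ ▸ Measure.isProbabilityMeasure_map hX.aemeasurable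
  let j : {x // x ∈ A} ⊕ {x // x ∈ B} → Fin N := Sum.elim (fun a => a.1) (fun b => b.1)
  let j' : {x // x ∈ A} ⊕ {x // x ∈ B} → Fin N := Sum.elim (fun a => a.1) (fun b => (g b).1)
  let φ : (Fin N → ℝ) → ℝ × ({x // x ∈ A} ⊕ {x // x ∈ B} → ℝ) := fun x => (x i, fun k => x (j k))
  let φ' : (Fin N → ℝ) → ℝ × ({x // x ∈ A} ⊕ {x // x ∈ B} → ℝ) :=
    fun x => (x i, fun k => x (j' k))
  have hφ : Measurable φ := by fun_prop
  have hφ' : Measurable φ' := by fun_prop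
  have hLL : Q.map φ' = Q.map φ := by
    have hm : Measurable (fun p : ℝ × ({x // x ∈ A} → ℝ) × ({x // x ∈ B} → ℝ) =>
        (p.1, Sum.elim p.2.1 p.2.2)) :=
      measurable_fst.prodMk (s14_measurable_elim _ _ (by fun_prop) (by fun_prop))
    have := congrArg (fun m => m.map (fun p : ℝ × ({x // x ∈ A} → ℝ) × ({x // x ∈ B} → ℝ) =>
        (p.1, Sum.elim p.2.1 p.2.2))) hdist
    rw [Measure.map_map hm (by fun_prop), Measure.map_map hm (by fun_prop)] at this
    rw [← hXQ, Measure.map_map hφ' hX, Measure.map_map hφ hX]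
    refine Eq.trans ?_ (this.symm.trans ?_)
    · congr 1
      ext ω k
      · rfl
      · rcases k with a | b <;> rfl
    · congr 1
      ext ω k
      · rfl
      · rcases k with a | b <;> rfl
  have : IsProbabilityMeasure (Q.map φ) := Measure.isProbabilityMeasure_map hφ.aemeasurable
  obtain ⟨f, hf, key⟩ := s14_key PZ (Q.map φ) ((bpskImage C).image φ)
    (by
      refine (ae_map_iff hφ.aemeasurable (Finset.measurableSet ((bpskImage C).image φ))).2 ?_
      filter_upwards [s14_unif_mem (bpskImage C)] with x hx
      exact Finset.mem_image_of_mem _ hx)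
    (by
      intro u hu
      obtain ⟨x, hx, rfl⟩ := Finset.mem_image.1 hu
      obtain ⟨c, _, rfl⟩ := (s14_mem_image C x).1 hx
      have h := s14_bpsk_sq c
      exact Prod.ext (congrFun h i) (funext fun k => congrFun h (j k)))
    (by
      intro u hu
      obtain ⟨x, hx, rfl⟩ := Finset.mem_image.1 hu
      have h := s14_unif_inv C hadd x hx
      rw [Measure.map_map (measurable_const_mul _) hφ]
      conv_rhs => rw [hQ, ← h, Measure.map_map hφ (measurable_const_mul _)]
      rfl)
  let e2 : {x // x ∈ A} ⊕ {x // x ∈ B} → Fin N ⊕ Fin N :=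
    Sum.elim (fun a => Sum.inl a.1) (fun b => Sum.inr b.1)
  have dAB : ∀ (a : {x // x ∈ A}) (b : {x // x ∈ B}), a.1 ≠ b.1 := fun a b h =>
    Finset.disjoint_left.1 hAB a.2 (h ▸ b.2)
  have dAC : ∀ (a : {x // x ∈ A}) (b : {x // x ∈ C'}), a.1 ≠ b.1 := fun a b h =>
    Finset.disjoint_left.1 hAC a.2 (h ▸ b.2)
  have dBC : ∀ (a : {x // x ∈ B}) (b : {x // x ∈ C'}), a.1 ≠ b.1 := fun a b h =>
    Finset.disjoint_left.1 hBC a.2 (h ▸ b.2)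
  have gval : Function.Injective (fun b => (g b).1) := Subtype.val_injective.comp g.injective
  have hj : Function.Injective j := Subtype.val_injective.sumElim Subtype.val_injective dAB
  have hj' : Function.Injective j' := Subtype.val_injective.sumElim gval (fun a b => dAC a (g b))
  have he2 : Function.Injective e2 :=
    (Sum.inl_injective.comp Subtype.val_injective).sumElim
      (Sum.inr_injective.comp Subtype.val_injective) (fun a b => Sum.inl_ne_inr)
  have hW : ∀ {K : Type} [Fintype K] (e : K → Fin N ⊕ Fin N),
      Measurable (fun ω k => Sum.elim (Z ω) (Z' ω) (e k)) := fun e =>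
    measurable_pi_lambda _ fun k =>
      (measurable_pi_apply (e k)).comp (s14_measurable_elim _ _ hZ hZ')
  have k1 := key μ (fun ω => φ (X ω)) _ (hφ.comp hX) (hW fun k => Sum.inl (j k))
    (s14_law μ Q PZ X Z Z' hX hZ hZ' hlaw φ hφ _ (Sum.inl_injective.comp hj))
  have k2 := key μ (fun ω => φ (X ω)) _ (hφ.comp hX) (hW e2)
    (s14_law μ Q PZ X Z Z' hX hZ hZ' hlaw φ hφ _ he2)
  have k3 := key μ (fun ω => φ' (X ω)) _ (hφ'.comp hX) (hW fun k => Sum.inl (j' k))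
    (by
      rw [← hLL]
      exact s14_law μ Q PZ X Z Z' hX hZ hZ' hlaw φ' hφ' _ (Sum.inl_injective.comp hj'))
  have c1 := s14_condMean_congr μ (fun ω' => X ω' i)
    (fun ω' => ((fun a : {x // x ∈ A} => X ω' a.1 * Z ω' a.1),
                (fun b : {x // x ∈ B} => X ω' b.1 * Z ω' b.1)))
    (fun ω => (φ (X ω)).2 * fun k => Sum.elim (Z ω) (Z' ω) (Sum.inl (j k)))
    (fun p => Sum.elim p.1 p.2) (fun w => (fun a => w (Sum.inl a), fun b => w (Sum.inr b)))
    (s14_measurable_elim _ _ (by fun_prop) (by fun_prop)) (by fun_prop)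
    (fun ω => by ext k; rcases k with a | b <;> rfl) (fun ω => rfl)
  have c2 := s14_condMean_congr μ (fun ω' => X ω' i)
    (fun ω' => ((fun a : {x // x ∈ A} => X ω' a.1 * Z ω' a.1),
                (fun b : {x // x ∈ B} => X ω' b.1 * Z' ω' b.1)))
    (fun ω => (φ (X ω)).2 * fun k => Sum.elim (Z ω) (Z' ω) (e2 k))
    (fun p => Sum.elim p.1 p.2) (fun w => (fun a => w (Sum.inl a), fun b => w (Sum.inr b)))
    (s14_measurable_elim _ _ (by fun_prop) (by fun_prop)) (by fun_prop)
    (fun ω => by ext k; rcases k with a | b <;> rfl) (fun ω => rfl)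
  have c3 := s14_condMean_congr μ (fun ω' => X ω' i)
    (fun ω' => ((fun a : {x // x ∈ A} => X ω' a.1 * Z ω' a.1),
                (fun c : {x // x ∈ C'} => X ω' c.1 * Z ω' c.1)))
    (fun ω => (φ' (X ω)).2 * fun k => Sum.elim (Z ω) (Z' ω) (Sum.inl (j' k)))
    (fun p => Sum.elim p.1 (fun b => p.2 (g b)))
    (fun w => (fun a => w (Sum.inl a), fun c => w (Sum.inr (g.symm c))))
    (s14_measurable_elim _ _ (by fun_prop) (by fun_prop)) (by fun_prop)
    (fun ω => by ext k; rcases k with a | b <;> rfl)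
    (fun ω => by
      refine Prod.ext rfl (funext fun c => ?_)
      simp [φ', j'])
  rw [c1, c2, c3]
  let α1 : {x // x ∈ A} ⊕ {x // x ∈ B} → {x // x ∈ A} ⊕ ({x // x ∈ B} ⊕ {x // x ∈ B}) :=
    Sum.elim Sum.inl (fun b => Sum.inr (Sum.inl b))
  let α2 : {x // x ∈ A} ⊕ {x // x ∈ B} → {x // x ∈ A} ⊕ ({x // x ∈ B} ⊕ {x // x ∈ B}) :=
    Sum.elim Sum.inl (fun b => Sum.inr (Sum.inr b))
  let H : ℝ × ({x // x ∈ A} ⊕ ({x // x ∈ B} ⊕ {x // x ∈ B}) → ℝ) → ℝ × ℝ :=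
    fun p => (p.1 * f (fun k => p.2 (α1 k)), p.1 * f (fun k => p.2 (α2 k)))
  have hH : Measurable H := by fun_prop
  let E2 : {x // x ∈ A} ⊕ ({x // x ∈ B} ⊕ {x // x ∈ B}) → Fin N ⊕ Fin N :=
    Sum.elim (fun a => Sum.inl a.1) (Sum.elim (fun b => Sum.inl b.1) (fun b => Sum.inr b.1))
  let E3 : {x // x ∈ A} ⊕ ({x // x ∈ B} ⊕ {x // x ∈ B}) → Fin N ⊕ Fin N :=
    fun k => Sum.inl (Sum.elim (fun a => a.1) (Sum.elim (fun b => b.1) (fun b => (g b).1)) k)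
  have hE2 : Function.Injective E2 := by
    refine (Sum.inl_injective.comp Subtype.val_injective).sumElim
      ((Sum.inl_injective.comp Subtype.val_injective).sumElim
        (Sum.inr_injective.comp Subtype.val_injective) (fun a b => Sum.inl_ne_inr)) ?_
    rintro a (b | b)
    · exact fun h => dAB a b (Sum.inl_injective h)
    · exact Sum.inl_ne_inr
  have hE3 : Function.Injective E3 := by
    refine Sum.inl_injective.comp (Subtype.val_injective.sumElim
      (Subtype.val_injective.sumElim gval (fun a b => dBC a (g b))) ?_)
    rintro a (b | b)
    · exact dAB a b
    · exact dAC a (g b)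
  have hi : Measurable (fun x : Fin N → ℝ => x i) := measurable_pi_apply i
  have hXi : Measurable (fun ω => X ω i) := hi.comp hX
  have l2 := s14_law μ Q PZ X Z Z' hX hZ hZ' hlaw (fun x => x i) hi E2 hE2
  have l3 := s14_law μ Q PZ X Z Z' hX hZ hZ' hlaw (fun x => x i) hi E3 hE3
  have l := congrArg (fun m => m.map H) (l2.trans l3.symm)
  rw [Measure.map_map hH (hXi.prodMk (hW E2)),
    Measure.map_map hH (hXi.prodMk (hW E3))] at l
  refine (Measure.map_congr ?_).trans (l.trans (Measure.map_congr ?_))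
  · filter_upwards [k1, k2] with ω a1 a2
    refine Prod.ext (a1.trans ?_) (a2.trans ?_)
    · refine congrArg (fun w => X ω i * f w) (funext fun k => ?_)
      rcases k with a | b <;> rfl
    · refine congrArg (fun w => X ω i * f w) (funext fun k => ?_)
      rcases k with a | b <;> rfl
  · filter_upwards [k1, k3] with ω a1 a2
    refine Prod.ext (Eq.symm (a1.trans ?_)) (Eq.symm (a2.trans ?_))
    · refine congrArg (fun w => X ω i * f w) (funext fun k => ?_)
      rcases k with a | b <;> rfl
    · refine congrArg (fun w => X ω i * f w) (funext fun k => ?_)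
      rcases k with a | b <;> rfl
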